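/- Let ρ be a density matrix on ℂ^d (positive semidefinite with trace 1), with orthonormal eigenbasis (v_i)_{i∈ι} and corresponding eigenvalues (r_i)_{i∈ι}. Fix s ∈ ℝ, ε > 0, n ∈ ℕ, and α_n ≥ 0. Let A = { i ∈ ι : 2^{-n(s+ε)} ≤ r_i ≤ 2^{-n(s-ε)} } and suppose Σ_{i∈A} r_i > 1 − ε. Let B ⊆ ι be any subset whose complement satisfies card(ι \ B) ≤ 2^{n(s-2ε)+α_n}, and set p = Σ_{i ∈ A ∩ B} v_i v_iᴴ. Then: (1) Tr(ρ p) > 1 − ε − 2^{-nε+α_n}; (2) (1 − ε − 2^{-nε+α_n}) · 2^{n(s-ε)} ≤ Tr(p) ≤ 2^{n(s+ε)}; (3) for every rank-one orthogonal projection q with q ≤ p, 2^{-n(s+ε)} ≤ Tr(ρ q) ≤ 2^{-n(s-ε)}. -/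

import Mathlib

open Matrix
open scoped ComplexOrder

namespace Matrix

variable {m ι : Type*} [Fintype m]

/-- The trace of a weighted sum of rank-one operators against a matrix. -/
lemma trace_sum_smul_vecMulVec_star_mul (S : Finset ι) (c : ι → ℂ) (v : ι → m → ℂ)
    (q : Matrix m m ℂ) :
    ((∑ i ∈ S, c i • vecMulVec (v i) (star (v i))) * q).trace =
      ∑ i ∈ S, c i * (star (v i) ⬝ᵥ q *ᵥ v i) := by
  simp only [Finset.sum_mul, trace_sum, smul_mul, trace_smul, smul_eq_mul, vecMulVec_mul,
    trace_vecMulVec]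
  refine Finset.sum_congr rfl fun i _ => ?_
  rw [dotProduct_mulVec, dotProduct_comm]

/-- Over an orthonormal family, a sum of rank-one projections acts as a coordinate projection. -/
lemma star_vecMul_sum_vecMulVec_star [DecidableEq ι] {v : ι → m → ℂ}
    (horth : ∀ i j, star (v i) ⬝ᵥ v j = if i = j then (1 : ℂ) else 0) (S : Finset ι) (i : ι) :
    star (v i) ᵥ* (∑ j ∈ S, vecMulVec (v j) (star (v j))) =
      if i ∈ S then star (v i) else 0 := by
  simp [vecMul_sum, vecMul_vecMulVec, horth, ite_smul]

/-- A self-adjoint idempotent has nonnegative quadratic form. -/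
lemma dotProduct_mulVec_nonneg_of_projection {q : Matrix m m ℂ} (hq : q * q = q) (hqs : qᴴ = q)
    (x : m → ℂ) : 0 ≤ star x ⬝ᵥ q *ᵥ x := by
  have h := (posSemidef_conjTranspose_mul_self q).dotProduct_mulVec_nonneg x
  rwa [hqs, hq] at h

end Matrix

/-- A sum over `A ∩ B` is at least the sum over `A` minus a bound on the terms in `A` times a
bound on the size of the complement of `B`. -/
lemma sum_sub_mul_le_sum_inter {ι : Type*} [Fintype ι] [DecidableEq ι] (r : ι → ℝ)
    (A B : Finset ι) {M K : ℝ} (hM : 0 ≤ M) (hr : ∀ i ∈ A, r i ≤ M)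
    (hK : ((Finset.univ \ B).card : ℝ) ≤ K) :
    ∑ i ∈ A, r i - K * M ≤ ∑ i ∈ A ∩ B, r i := by
  have h1 : ∑ i ∈ A \ B, r i ≤ (A \ B).card • M :=
    Finset.sum_le_card_nsmul _ _ _ fun i hi => hr i (Finset.mem_sdiff.mp hi).1
  have h2 : ((A \ B).card : ℝ) ≤ K := by
    refine le_trans (Nat.cast_le.mpr (Finset.card_le_card ?_)) hK
    exact Finset.sdiff_subset_sdiff (Finset.subset_univ A) le_rfl
  have h3 := Finset.sum_inter_add_sum_sdiff A B r
  rw [nsmul_eq_mul] at h1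
  nlinarith [mul_le_mul_of_nonneg_right h2 hM]

/-- Finite-dimensional content of the quantum Brudno theorem: for a density
matrix `ρ` with orthonormal eigenbasis `v` and eigenvalues `r`, the typical
projection `p` built from the `ε`-typical eigenvalues `A` intersected with any
set `B` of small universal eigenvalues (with controlled complement) has large
probability, dimension controlled by the entropy rate `s`, and every rank-one
projection below it has `ω`-probability between `2^{-n(s+ε)}` and `2^{-n(s-ε)}`. -/
theorem quantum_typical_projection_bounds {d : ℕ} {ι : Type*}
    [Fintype ι] [DecidableEq ι] (hcard : Fintype.card ι = d)
    (v : ι → (Fin d → ℂ)) (r : ι → ℝ)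
    (horth : ∀ i j, star (v i) ⬝ᵥ v j = if i = j then (1 : ℂ) else 0)
    (hr0 : ∀ i, 0 ≤ r i) (hr1 : ∑ i, r i = 1)
    (ρ : Matrix (Fin d) (Fin d) ℂ)
    (hρ : ρ = ∑ i, (r i : ℂ) • vecMulVec (v i) (star (v i)))
    (s ε : ℝ) (hε : 0 < ε) (n : ℕ) (αn : ℝ) (hαn : 0 ≤ αn)
    (A B : Finset ι)
    (hA : ∀ i, i ∈ A ↔
      ((2 : ℝ) ^ (-(n : ℝ) * (s + ε)) ≤ r i ∧ r i ≤ (2 : ℝ) ^ (-(n : ℝ) * (s - ε))))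
    (hAsum : 1 - ε < ∑ i ∈ A, r i)
    (hB : ((Finset.univ \ B).card : ℝ) ≤ (2 : ℝ) ^ ((n : ℝ) * (s - 2 * ε) + αn))
    (p : Matrix (Fin d) (Fin d) ℂ)
    (hp : p = ∑ i ∈ A ∩ B, vecMulVec (v i) (star (v i))) :
    (((1 - ε - (2 : ℝ) ^ (-(n : ℝ) * ε + αn) : ℝ) : ℂ) < (ρ * p).trace) ∧
    ((((1 - ε - (2 : ℝ) ^ (-(n : ℝ) * ε + αn)) * (2 : ℝ) ^ ((n : ℝ) * (s - ε)) : ℝ) : ℂ)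
        ≤ p.trace ∧
      p.trace ≤ (((2 : ℝ) ^ ((n : ℝ) * (s + ε)) : ℝ) : ℂ)) ∧
    (∀ q : Matrix (Fin d) (Fin d) ℂ,
      q * q = q → qᴴ = q → q.trace = 1 → p * q = q →
      (((2 : ℝ) ^ (-(n : ℝ) * (s + ε)) : ℝ) : ℂ) ≤ (ρ * q).trace ∧
        (ρ * q).trace ≤ (((2 : ℝ) ^ (-(n : ℝ) * (s - ε)) : ℝ) : ℂ)) := by
  have two_pos : (0 : ℝ) < 2 := by norm_num
  have hlo : ∀ i ∈ A ∩ B, (2 : ℝ) ^ (-(n : ℝ) * (s + ε)) ≤ r i := fun i hi =>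
    ((hA i).mp (Finset.mem_inter.mp hi).1).1
  have hhi : ∀ i ∈ A ∩ B, r i ≤ (2 : ℝ) ^ (-(n : ℝ) * (s - ε)) := fun i hi =>
    ((hA i).mp (Finset.mem_inter.mp hi).1).2
  have hmass : 1 - ε - (2 : ℝ) ^ (-(n : ℝ) * ε + αn) < ∑ i ∈ A ∩ B, r i := by
    have h := sum_sub_mul_le_sum_inter r A B (Real.rpow_nonneg two_pos.le _)
      (fun i hi => ((hA i).mp hi).2) hB
    rw [← Real.rpow_add two_pos, show (n : ℝ) * (s - 2 * ε) + αn + -(n : ℝ) * (s - ε)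
      = -(n : ℝ) * ε + αn by ring] at h
    linarith
  have htrace : ∀ q, (ρ * q).trace = ∑ i, (r i : ℂ) * (star (v i) ⬝ᵥ q *ᵥ v i) := fun q => by
    rw [hρ, trace_sum_smul_vecMulVec_star_mul]
  have hvp : ∀ i, star (v i) ᵥ* p = if i ∈ A ∩ B then star (v i) else 0 := fun i => by
    rw [hp, star_vecMul_sum_vecMulVec_star horth]
  have hptrace : p.trace = (((A ∩ B).card : ℝ) : ℂ) := by
    rw [hp, trace_sum]
    simp only [trace_vecMulVec, dotProduct_comm _ (star _), horth]
    simp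
  refine ⟨?_, ⟨?_, ?_⟩, ?_⟩
  · have h : (ρ * p).trace = ((∑ i ∈ A ∩ B, r i : ℝ) : ℂ) := by
      rw [htrace]
      simp only [dotProduct_mulVec, hvp]
      rw [Complex.ofReal_sum, ← Finset.sum_subset (Finset.subset_univ (A ∩ B))]
      · refine Finset.sum_congr rfl fun i hi => ?_
        rw [if_pos hi, horth, if_pos rfl, mul_one]
      · intro i _ hi
        rw [if_neg hi, zero_dotProduct, mul_zero]
    rw [h]
    exact Complex.real_lt_real.mpr hmass
  · rw [hptrace, Complex.real_le_real]
    have h1 := Finset.sum_le_card_nsmul _ _ _ hhi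
    rw [nsmul_eq_mul] at h1
    calc _ ≤ ((A ∩ B).card * (2 : ℝ) ^ (-(n : ℝ) * (s - ε))) * (2 : ℝ) ^ ((n : ℝ) * (s - ε)) :=
          mul_le_mul_of_nonneg_right (hmass.le.trans h1) (Real.rpow_nonneg two_pos.le _)
      _ = (A ∩ B).card := by
          rw [mul_assoc, ← Real.rpow_add two_pos, neg_mul, neg_add_cancel, Real.rpow_zero, mul_one]
  · rw [hptrace, Complex.real_le_real]
    have h1 := Finset.card_nsmul_le_sum _ _ _ hlo
    rw [nsmul_eq_mul] at h1
    have h2 : ∑ i ∈ A ∩ B, r i ≤ 1 := hr1 ▸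
      Finset.sum_le_sum_of_subset_of_nonneg (Finset.subset_univ _) fun i _ _ => hr0 i
    calc ((A ∩ B).card : ℝ)
        = ((A ∩ B).card * (2 : ℝ) ^ (-(n : ℝ) * (s + ε))) * (2 : ℝ) ^ ((n : ℝ) * (s + ε)) := by
          rw [mul_assoc, ← Real.rpow_add two_pos, neg_mul, neg_add_cancel, Real.rpow_zero, mul_one]
      _ ≤ 1 * (2 : ℝ) ^ ((n : ℝ) * (s + ε)) :=
          mul_le_mul_of_nonneg_right (h1.trans h2) (Real.rpow_nonneg two_pos.le _)
      _ = _ := one_mul _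
  · intro q hq hqs hqt hpq
    have hw := fun i => dotProduct_mulVec_nonneg_of_projection hq hqs (v i)
    have hsupp : ∀ i, i ∉ A ∩ B → star (v i) ⬝ᵥ q *ᵥ v i = 0 := fun i hi => by
      rw [← hpq, ← mulVec_mulVec, dotProduct_mulVec, hvp, if_neg hi, zero_dotProduct]
    have hsum : ∑ i ∈ A ∩ B, star (v i) ⬝ᵥ q *ᵥ v i = 1 := by
      have h := trace_sum_smul_vecMulVec_star_mul (A ∩ B) 1 v q
      simp only [Pi.one_apply, one_smul, one_mul] at h
      rw [← h, ← hp, hpq, hqt]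
    have hρq : (ρ * q).trace = ∑ i ∈ A ∩ B, (r i : ℂ) * (star (v i) ⬝ᵥ q *ᵥ v i) := by
      rw [htrace]
      refine (Finset.sum_subset (Finset.subset_univ _) fun i _ hi => ?_).symm
      rw [hsupp i hi, mul_zero]
    rw [hρq]
    constructor
    · rw [← mul_one (Complex.ofReal _), ← hsum, Finset.mul_sum]
      exact Finset.sum_le_sum fun i hi =>
        mul_le_mul_of_nonneg_right (Complex.real_le_real.mpr (hlo i hi)) (hw i)
    · rw [← mul_one (Complex.ofReal (_ ^ _)), ← hsum, Finset.mul_sum]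
      exact Finset.sum_le_sum fun i hi =>
        mul_le_mul_of_nonneg_right (Complex.real_le_real.mpr (hhi i hi)) (hw i)
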